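/- arXiv:2405.13033 — 2 statements merged into one kernel-verified Lean document; each statement's English description precedes it below -/
import Mathlib

section
/- If H is a regular Hadamard matrix of order n ≥ 4, i.e., an n-by-n matrix with entries in {−1, 1} satisfying H * Hᵀ = n • I whose row sums and column sums are all equal to a single common value, then n = 4h² for some positive integer h. -/
open Matrix BigOperators

/-- A sum of signs differs from the number of its terms by an even integer. -/
theorem exists_sum_signs_eq_card_sub_two_mul {ι : Type*} [Fintype ι] (f : ι → ℚ)
    (hf : ∀ i, f i = 1 ∨ f i = -1) :
    ∃ k : ℤ, ∑ i, f i = Fintype.card ι - 2 * k := by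
  have hk : ∀ i, ∃ k : ℤ, f i = 1 - 2 * k := fun i => by
    rcases hf i with h | h
    · exact ⟨0, by simp [h]⟩
    · exact ⟨1, by rw [h]; norm_num⟩
  choose k hk using hk
  exact ⟨∑ i, k i, by simp [hk, Finset.sum_sub_distrib, Finset.mul_sum]⟩

/-- If the columns of a nonempty square matrix `H` with `H * Hᵀ = n • 1` all have sum `r`,
then `r ^ 2` is the order of `H`. -/
theorem sq_col_sum_eq_order {n : ℕ} (hn : n ≠ 0) (H : Matrix (Fin n) (Fin n) ℚ) (r : ℚ)
    (hHad : H * Hᵀ = (n : ℚ) • (1 : Matrix (Fin n) (Fin n) ℚ))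
    (hcol : ∀ j, ∑ i, H i j = r) : r ^ 2 = n := by
  have hv : (1 : Fin n → ℚ) ᵥ* H = fun _ => r := by
    ext j
    simp [vecMul, dotProduct, hcol]
  have key : (1 ᵥ* H) ⬝ᵥ (1 ᵥ* H) = (n : ℚ) * n := by
    nth_rewrite 2 [← mulVec_transpose]
    rw [← dotProduct_mulVec, mulVec_mulVec, hHad, smul_mulVec, one_mulVec]
    simp
  have hn' : (n : ℚ) ≠ 0 := Nat.cast_ne_zero.mpr hn
  rw [hv] at key
  simp only [dotProduct, Finset.sum_const, Finset.card_univ, Fintype.card_fin,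
    nsmul_eq_mul] at key
  rw [sq]
  exact mul_left_cancel₀ hn' key

/-- A Hadamard matrix of order at least two has even order. -/
theorem even_order_of_mul_transpose_eq {n : ℕ} (hn : 2 ≤ n) (H : Matrix (Fin n) (Fin n) ℚ)
    (hent : ∀ i j, H i j = 1 ∨ H i j = -1)
    (hHad : H * Hᵀ = (n : ℚ) • (1 : Matrix (Fin n) (Fin n) ℚ)) : Even (n : ℤ) := by
  let a : Fin n := ⟨0, by omega⟩
  let b : Fin n := ⟨1, by omega⟩
  have hab : a ≠ b := by simp [a, b]
  have horth : ∑ j, H a j * H b j = 0 := by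
    simpa [mul_apply, hab] using congrFun (congrFun hHad a) b
  obtain ⟨k, hk⟩ := exists_sum_signs_eq_card_sub_two_mul (fun j => H a j * H b j) fun j => by
    rcases hent a j with h | h <;> rcases hent b j with h' | h' <;> simp [h, h']
  rw [horth, Fintype.card_fin] at hk
  have hk' : (0 : ℤ) = n - 2 * k := by exact_mod_cast hk
  exact ⟨k, by omega⟩

/-- If `H` is a regular Hadamard matrix of order `n ≥ 4` (entries in `{-1,1}`,
`H * Hᵀ = n • I`, and all row sums and column sums equal one common value `r`),
then `n = 4 h ^ 2` for some positive integer `h`. -/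
theorem regular_hadamard_order_eq_four_mul_sq (n : ℕ) (hn : 4 ≤ n)
    (H : Matrix (Fin n) (Fin n) ℚ) (r : ℚ)
    (hent : ∀ i j, H i j = 1 ∨ H i j = -1)
    (hHad : H * Hᵀ = (n : ℚ) • (1 : Matrix (Fin n) (Fin n) ℚ))
    (hrow : ∀ i, ∑ j, H i j = r)
    (hcol : ∀ j, ∑ i, H i j = r) :
    ∃ h : ℕ, 0 < h ∧ n = 4 * h ^ 2 := by
  have hr : r ^ 2 = n := sq_col_sum_eq_order (by omega) H r hHad hcol
  obtain ⟨k, hk⟩ := exists_sum_signs_eq_card_sub_two_mul (H ⟨0, by omega⟩) (hent _)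
  rw [hrow, Fintype.card_fin] at hk
  obtain ⟨l, hl⟩ := even_order_of_mul_transpose_eq (by omega) H hent hHad
  have hl' : (n : ℚ) = l + l := by exact_mod_cast hl
  have hsq : (n : ℤ) = 4 * (l - k) ^ 2 := by
    have h : (n : ℚ) = 4 * (l - k) ^ 2 := by rw [← hr, hk, hl']; ring
    exact_mod_cast h
  have hnat : n = 4 * (l - k).natAbs ^ 2 := by
    zify
    rw [sq_abs]
    exact hsq
  refine ⟨(l - k).natAbs, Nat.pos_of_ne_zero fun h0 => ?_, hnat⟩
  rw [h0] at hnat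
  omega
end

section
/- If H is a circulant Hadamard matrix of order n = 4h² for a positive integer h, then h is odd. -/
open Matrix BigOperators

/-- The sum of `a` over the first `L` terms of the progression `i, i + M, i + 2 M, …`. -/
def foldSum (a : ℕ → ℤ) (M L i : ℕ) : ℤ := ∑ q ∈ Finset.range L, a (i + M * q)

theorem sum_range_mul_eq_sum_sum {R : Type*} [AddCommMonoid R] (g : ℕ → R) (M L : ℕ) :
    ∑ k ∈ Finset.range (M * L), g k =
      ∑ r ∈ Finset.range M, ∑ q ∈ Finset.range L, g (r + M * q) := by
  induction L with
  | zero => simp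
  | succ L ih =>
    simp only [Nat.mul_succ, Finset.sum_range_add, ih, Finset.sum_range_succ,
      Finset.sum_add_distrib]
    simp only [add_comm]

theorem sum_range_add_of_periodic {R : Type*} [AddCommMonoid R] {g : ℕ → R} {n : ℕ}
    (hg : Function.Periodic g n) (d : ℕ) :
    ∑ k ∈ Finset.range n, g (k + d) = ∑ k ∈ Finset.range n, g k := by
  induction d with
  | zero => simp
  | succ d ih =>
    rw [← ih]
    cases n with
    | zero => simp
    | succ m =>
      rw [Finset.sum_range_succ, Finset.sum_range_succ' (fun k => g (k + d))]
      congr 1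
      · exact Finset.sum_congr rfl fun k _ => by congr 1; ring
      · rw [← hg (0 + d)]; congr 1; ring

theorem foldSum_two_mul (a : ℕ → ℤ) (M L i : ℕ) :
    foldSum a M (2 * L) i = foldSum a (2 * M) L i + foldSum a (2 * M) L (i + M) := by
  simp only [foldSum, sum_range_mul_eq_sum_sum, Finset.sum_range_succ, Finset.sum_range_zero,
    zero_add]
  congr 1 <;> exact Finset.sum_congr rfl fun k _ => by congr 1; ring

theorem foldSum_periodic {a : ℕ → ℤ} {M L : ℕ} (ha : Function.Periodic a (M * L)) (i : ℕ) :
    foldSum a M L (i + M) = foldSum a M L i := by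
  have hg : Function.Periodic (fun q => a (i + M * q)) L := fun q => by
    change a (i + M * (q + L)) = a (i + M * q)
    rw [← ha (i + M * q)]; congr 1; ring
  rw [foldSum, foldSum, ← sum_range_add_of_periodic hg 1]
  exact Finset.sum_congr rfl fun k _ => by congr 1; ring

theorem foldSum_add_mul {a : ℕ → ℤ} {M L : ℕ} (ha : Function.Periodic a (M * L)) (i q : ℕ) :
    foldSum a M L (i + M * q) = foldSum a M L i := by
  induction q with
  | zero => simp
  | succ q ih => rw [Nat.mul_succ, ← add_assoc, foldSum_periodic ha, ih]

theorem sum_foldSum_sq {a : ℕ → ℤ} {M L : ℕ} (hM : 0 < M) (hL : 0 < L)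
    (ha : Function.Periodic a (M * L))
    (hcorr : ∀ d, ∑ k ∈ Finset.range (M * L), a k * a (k + d) =
      if M * L ∣ d then ((M * L : ℕ) : ℤ) else 0) :
    ∑ r ∈ Finset.range M, foldSum a M L r ^ 2 = ((M * L : ℕ) : ℤ) := by
  have h1 : ∑ r ∈ Finset.range M, foldSum a M L r ^ 2 =
      ∑ k ∈ Finset.range (M * L), a k * foldSum a M L k := by
    rw [sum_range_mul_eq_sum_sum]
    refine Finset.sum_congr rfl fun r _ => ?_
    simp only [foldSum_add_mul ha]
    rw [← Finset.sum_mul, sq]; rfl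
  rw [h1]
  simp only [foldSum, Finset.mul_sum]
  rw [Finset.sum_comm]
  simp only [hcorr]
  rw [Finset.sum_eq_single_of_mem 0 (by simpa using hL)]
  · simp
  · intro q hq hq0
    rw [if_neg]
    intro hd
    have := Nat.le_of_dvd (Nat.pos_of_ne_zero hq0) (Nat.dvd_of_mul_dvd_mul_left hM hd)
    simp at hq
    omega

theorem odd_foldSum {a : ℕ → ℤ} (ha : ∀ k, Odd (a k)) (M : ℕ) {L : ℕ} (hL : Odd L) (i : ℕ) :
    Odd (foldSum a M L i) := by
  have h (l : ℕ) : Odd (∑ q ∈ Finset.range l, a (i + M * q)) ↔ Odd l := by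
    induction l with
    | zero => simp
    | succ l ih => simp only [Finset.sum_range_succ, Int.odd_add', ih, ha, Nat.odd_add_one,
        true_iff, ← Int.not_odd_iff_even]
  exact (h L).2 hL

theorem one_sub_pow_two_pow_dvd {R : Type*} [CommRing R] {x : R} {r : ℕ}
    (hx : x ^ 2 ^ r = -1) (q : ℕ) (hq : q ≤ r) :
    (1 - x) ^ 2 ^ q ∣ 1 - x ^ 2 ^ q ∧ 1 - x ^ 2 ^ q ∣ (1 - x) ^ 2 ^ q := by
  induction q with
  | zero => simp
  | succ q ih =>
    obtain ⟨h1, h2⟩ := ih (by omega)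
    obtain ⟨e, rfl⟩ : ∃ e, r = q + 1 + e := ⟨r - (q + 1), by omega⟩
    set w := x ^ 2 ^ q with hw
    have hwe : w ^ (2 * 2 ^ e) = -1 := by
      rw [hw, ← pow_mul, ← hx]; congr 1; ring
    have h3 : 1 - w ∣ 1 + w := by
      have := sub_dvd_pow_sub_pow 1 w (2 * 2 ^ e + 1)
      rw [pow_succ w, hwe] at this
      simpa using this
    have h4 : 1 + w ∣ 1 - w := by
      have := Odd.add_dvd_pow_add_pow 1 w (n := 2 * 2 ^ e + 1) ⟨_, rfl⟩
      rw [pow_succ w, hwe] at this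
      simpa [sub_eq_add_neg] using this
    have h5 : 1 - x ^ 2 ^ (q + 1) = (1 - w) * (1 + w) := by
      rw [pow_succ 2, pow_mul, ← hw]; ring
    have h6 : (1 - x) ^ 2 ^ (q + 1) = (1 - x) ^ 2 ^ q * (1 - x) ^ 2 ^ q := by
      rw [pow_succ 2, pow_mul]; ring
    rw [h5, h6]
    exact ⟨mul_dvd_mul h1 (h1.trans h3), mul_dvd_mul h2 (h4.trans h2)⟩

/-- An element `π` associated to its conjugate, and prime in the sense that `π ∣ C` is detected
by a conjugation-invariant homomorphism to a domain, has even valuation at every norm `C * σ C`. -/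
theorem pow_dvd_of_pow_two_mul_dvd_mul_map {R S : Type*} [CommRing R] [CommRing S] [IsDomain S]
    {π v : R} (σ : R →+* R) (ε : R →+* S) (hεσ : ∀ c, ε (σ c) = ε c)
    (hε : ∀ c, ε c = 0 ↔ π ∣ c) (hσ : σ π = v * π) (hv : IsUnit v)
    (hπ : ∀ c, π * c = 0 → c = 0) (m : ℕ) (C : R) (hC : π ^ (2 * m) ∣ C * σ C) :
    π ^ m ∣ C := by
  induction m generalizing C with
  | zero => simp
  | succ m ih =>
    have h1 : ε (C * σ C) = 0 := (hε _).2 ((dvd_pow_self π (by omega)).trans hC)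
    rw [map_mul, hεσ, mul_self_eq_zero, hε] at h1
    obtain ⟨c, rfl⟩ := h1
    obtain ⟨t, ht⟩ := hC
    rw [map_mul, hσ] at ht
    have h2 : v * (c * σ c) = π ^ (2 * m) * t := by
      refine sub_eq_zero.1 (hπ _ (hπ _ ?_))
      linear_combination ht
    rw [pow_succ']
    exact mul_dvd_mul_left _ (ih c (hv.dvd_mul_left.1 ⟨t, h2⟩))

open Polynomial in
theorem AdjoinRoot.dvd_coeff_of_dvd_mk {P p : ℤ[X]} (hP : P.Monic) (hdeg : p.degree < P.degree)
    {c : ℤ} (hc : (c : AdjoinRoot P) ∣ AdjoinRoot.mk P p) (i : ℕ) : c ∣ p.coeff i := by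
  obtain ⟨z, hz⟩ := hc
  obtain ⟨q, rfl⟩ := AdjoinRoot.mk_surjective z
  have h1 : AdjoinRoot.mk P p = AdjoinRoot.mk P (C c * (q %ₘ P)) := by
    rw [hz, map_mul, AdjoinRoot.mk_C]
    congr 1
    rw [AdjoinRoot.mk_eq_mk]
    exact ⟨q /ₘ P, by linear_combination -(modByMonic_add_div q P)⟩
  rw [AdjoinRoot.mk_eq_mk] at h1
  have h2 : p - C c * (q %ₘ P) = 0 := by
    by_contra h0
    refine hP.not_dvd_of_degree_lt h0 ?_ h1
    refine (degree_sub_le _ _).trans_lt (max_lt hdeg ?_)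
    refine lt_of_le_of_lt ?_ (degree_modByMonic_lt q hP)
    rw [← smul_eq_C_mul]
    exact degree_smul_le _ _
  rw [sub_eq_zero.1 h2, coeff_C_mul]
  exact dvd_mul_right _ _

open Polynomial in
theorem AdjoinRoot.eq_zero_of_intCast_mul_eq_zero {P : ℤ[X]} (hP : P.Monic) {c : ℤ} (hc : c ≠ 0)
    {z : AdjoinRoot P} (hz : (c : AdjoinRoot P) * z = 0) : z = 0 := by
  have : Module.Free ℤ (AdjoinRoot P) := hP.free_adjoinRoot
  rw [← zsmul_eq_mul] at hz
  exact (smul_eq_zero.1 hz).resolve_left hc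

theorem sum_mul_sum_eq_of_autocorrelation {R : Type*} [CommRing R] {a : ℕ → ℤ} {n : ℕ}
    (hn : 0 < n) (ha : Function.Periodic a n)
    (hcorr : ∀ d, ∑ k ∈ Finset.range n, a k * a (k + d) = if n ∣ d then (n : ℤ) else 0)
    {x y : R} (hxy : x * y = 1) (hx : x ^ n = 1) :
    (∑ k ∈ Finset.range n, (a k : R) * x ^ k) * (∑ k ∈ Finset.range n, (a k : R) * y ^ k) = n := by
  have hg : Function.Periodic (fun k => (a k : R) * x ^ k) n := fun k => by
    simp only [ha k, pow_add, hx, mul_one]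
  calc _ = ∑ k ∈ Finset.range n, ∑ d ∈ Finset.range n, ((a k * a (k + d) : ℤ) : R) * x ^ d := by
        rw [mul_comm, Finset.sum_mul]
        refine Finset.sum_congr rfl fun k _ => ?_
        rw [← sum_range_add_of_periodic hg k, Finset.mul_sum]
        refine Finset.sum_congr rfl fun d _ => ?_
        have : x ^ k * y ^ k = 1 := by rw [← mul_pow, hxy, one_pow]
        rw [add_comm d k, pow_add]
        push_cast
        linear_combination (a k * a (k + d) * x ^ d : R) * this
    _ = n := by
        rw [Finset.sum_comm]
        simp only [← Finset.sum_mul, ← Int.cast_sum, hcorr]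
        rw [Finset.sum_eq_single_of_mem 0 (by simpa using hn)]
        · simp
        · intro d hd hd0
          rw [if_neg fun h => ?_]
          · simp
          · have := Nat.le_of_dvd (Nat.pos_of_ne_zero hd0) h
            simp at hd
            omega

open Polynomial in
/-- In `ℤ[X] / (X ^ 2 ^ r + 1)`, where `2` is totally ramified and invariant under the conjugation
`x ↦ x⁻¹`, a divisibility of the norm by `4 ^ e` forces divisibility by `2 ^ e`. -/
theorem AdjoinRoot.two_pow_dvd_sum_of_four_pow_dvd_mul (r e n : ℕ) (a : ℕ → ℤ)
    (h : ∀ y : AdjoinRoot (X ^ 2 ^ r + 1 : ℤ[X]), AdjoinRoot.root _ * y = 1 →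
      (4 : AdjoinRoot (X ^ 2 ^ r + 1 : ℤ[X])) ^ e ∣
        (∑ k ∈ Finset.range n, (a k : AdjoinRoot (X ^ 2 ^ r + 1 : ℤ[X])) * AdjoinRoot.root _ ^ k) *
        (∑ k ∈ Finset.range n, (a k : AdjoinRoot (X ^ 2 ^ r + 1 : ℤ[X])) * y ^ k)) :
    (2 : AdjoinRoot (X ^ 2 ^ r + 1 : ℤ[X])) ^ e ∣
      ∑ k ∈ Finset.range n, (a k : AdjoinRoot (X ^ 2 ^ r + 1 : ℤ[X])) * AdjoinRoot.root _ ^ k := by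
  set P : ℤ[X] := X ^ 2 ^ r + 1 with hP
  have hPm : P.Monic := monic_X_pow_add_C 1 (by positivity)
  set x := AdjoinRoot.root P with hxdef
  have hx : x ^ 2 ^ r = -1 := by
    have := AdjoinRoot.eval₂_root P
    rw [hP] at this
    simp only [eval₂_add, eval₂_X_pow, eval₂_one] at this
    exact eq_neg_of_add_eq_zero_left this
  obtain ⟨y, hxy⟩ : ∃ y, x * y = 1 := by
    refine ⟨-x ^ (2 ^ r - 1), ?_⟩
    rw [mul_neg, ← pow_succ', Nat.sub_add_cancel Nat.one_le_two_pow, hx, neg_neg]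
  have hy : y ^ 2 ^ r = -1 := by
    have := congrArg (· ^ 2 ^ r) hxy
    simp only [mul_pow, hx, one_pow] at this
    linear_combination -this
  let σ : AdjoinRoot P →+* AdjoinRoot P :=
    AdjoinRoot.lift (Int.castRingHom _) y (by simp [hP, hy])
  let ε : AdjoinRoot P →+* ZMod 2 :=
    AdjoinRoot.lift (Int.castRingHom _) 1 (by simp [hP]; decide)
  have hσx : σ x = y := AdjoinRoot.lift_root _
  have hεx : ε x = 1 := AdjoinRoot.lift_root _
  have hεy : ε y = 1 := by simpa [hεx] using congrArg ε hxy
  obtain ⟨hd1, hd2⟩ := one_sub_pow_two_pow_dvd hx r le_rfl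
  rw [hx, sub_neg_eq_add, one_add_one_eq_two] at hd1 hd2
  have hπ2 : 1 - x ∣ 2 := (dvd_pow_self _ (by positivity)).trans hd1
  have key := pow_dvd_of_pow_two_mul_dvd_mul_map (π := 1 - x) (v := -y) σ ε ?_ ?_ ?_ ?_ ?_
    (2 ^ r * e) (∑ k ∈ Finset.range n, (a k : AdjoinRoot P) * x ^ k) ?_
  · rw [pow_mul] at key
    exact (pow_dvd_pow_of_dvd hd2 e).trans key
  · intro c
    have : ε.comp σ = ε := by
      refine AdjoinRoot.ringHom_ext (RingHom.ext_int _ _) ?_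
      change ε (σ x) = ε x
      rw [hσx, hεx, hεy]
    exact RingHom.congr_fun this c
  · intro c
    constructor
    · intro hc
      obtain ⟨p, rfl⟩ := AdjoinRoot.mk_surjective c
      have h1 : AdjoinRoot.mk P p =
          (p.eval 1 : ℤ) + AdjoinRoot.mk P (p - C (p.eval 1)) := by
        simp
      have h2 : 1 - x ∣ AdjoinRoot.mk P (p - C (p.eval 1)) := by
        have := map_dvd (AdjoinRoot.mk P) (X_sub_C_dvd_sub_C_eval (p := p) (a := 1))
        refine Dvd.dvd.trans ?_ this
        rw [← neg_dvd]
        simp [hxdef]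
      rw [h1]
      refine dvd_add ?_ h2
      obtain ⟨t, ht⟩ := h2
      rw [h1, ht] at hc
      simp only [map_add, map_mul, map_sub, map_one, hεx, sub_self, zero_mul, add_zero,
        map_intCast] at hc
      obtain ⟨z, hz⟩ := (ZMod.intCast_zmod_eq_zero_iff_dvd _ 2).1 hc
      rw [hz]
      push_cast
      exact hπ2.mul_right _
    · rintro ⟨t, rfl⟩
      simp [hεx]
  · rw [map_sub, map_one, hσx]
    linear_combination -hxy
  · exact (IsUnit.of_mul_eq_one x (by rw [mul_comm, hxy])).neg
  · intro c hc
    obtain ⟨t, ht⟩ := hπ2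
    refine AdjoinRoot.eq_zero_of_intCast_mul_eq_zero hPm (c := 2) two_ne_zero ?_
    push_cast
    rw [ht]
    linear_combination t * hc
  · refine Dvd.dvd.trans ?_ (h y hxy) |>.trans ?_
    · rw [show 2 * (2 ^ r * e) = 2 ^ r * 2 * e by ring, pow_mul, pow_mul]
      have h2 := pow_dvd_pow_of_dvd hd1 2
      rw [show (2 : AdjoinRoot P) ^ 2 = 4 by norm_num] at h2
      exact pow_dvd_pow_of_dvd h2 e
    · rw [map_sum]
      simp [hσx]

open Polynomial in
theorem two_pow_dvd_foldSum_sub {a : ℕ → ℤ} {r e L : ℕ} (hL : 0 < L)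
    (ha : Function.Periodic a (2 ^ (r + 1) * L))
    (hcorr : ∀ d, ∑ k ∈ Finset.range (2 ^ (r + 1) * L), a k * a (k + d) =
      if 2 ^ (r + 1) * L ∣ d then ((2 ^ (r + 1) * L : ℕ) : ℤ) else 0)
    (he : 4 ^ e ∣ 2 ^ (r + 1) * L) {i : ℕ} (hi : i < 2 ^ r) :
    (2 : ℤ) ^ e ∣ foldSum a (2 ^ (r + 1)) L i - foldSum a (2 ^ (r + 1)) L (i + 2 ^ r) := by
  set P : ℤ[X] := X ^ 2 ^ r + 1 with hP
  have hPm : P.Monic := monic_X_pow_add_C 1 (by positivity)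
  have hx : AdjoinRoot.root P ^ 2 ^ r = -1 := by
    have := AdjoinRoot.eval₂_root P
    rw [hP] at this
    simp only [eval₂_add, eval₂_X_pow, eval₂_one] at this
    exact eq_neg_of_add_eq_zero_left this
  have hx2 : AdjoinRoot.root P ^ 2 ^ (r + 1) = 1 := by
    rw [pow_succ 2, pow_mul, hx]; norm_num
  have h1 := AdjoinRoot.two_pow_dvd_sum_of_four_pow_dvd_mul r e (2 ^ (r + 1) * L) a
    fun y hxy => by
      rw [sum_mul_sum_eq_of_autocorrelation (by positivity) ha hcorr hxy
        (by rw [pow_mul, hx2, one_pow])]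
      exact_mod_cast map_dvd (Nat.castRingHom (AdjoinRoot P)) he
  rw [← hP] at h1
  let f := foldSum a (2 ^ (r + 1)) L
  let p : ℤ[X] := ∑ j ∈ Finset.range (2 ^ r), C (f j - f (j + 2 ^ r)) * X ^ j
  have h2 : ∑ k ∈ Finset.range (2 ^ (r + 1) * L), (a k : AdjoinRoot P) * AdjoinRoot.root P ^ k =
      AdjoinRoot.mk P p := by
    rw [sum_range_mul_eq_sum_sum]
    simp only [pow_add _ _ (_ * _), pow_mul _ (2 ^ (r + 1)), hx2, one_pow, mul_one,
      ← Finset.sum_mul, ← Int.cast_sum]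
    change ∑ j ∈ Finset.range (2 ^ (r + 1)), (f j : AdjoinRoot P) * _ = _
    rw [pow_succ 2 r, mul_two, Finset.sum_range_add, ← Finset.sum_add_distrib, map_sum]
    refine Finset.sum_congr rfl fun j _ => ?_
    rw [pow_add, hx]
    simp only [map_mul, map_pow, AdjoinRoot.mk_X, map_sub, AdjoinRoot.mk_C, add_comm (2 ^ r) j]
    simp
    ring
  rw [h2] at h1
  have hdeg : p.degree < P.degree := by
    rw [hP, show (X ^ 2 ^ r + 1 : ℤ[X]) = X ^ 2 ^ r + C 1 by simp,
      degree_X_pow_add_C (by positivity)]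
    refine (degree_sum_le _ _).trans_lt ?_
    refine (Finset.sup_lt_iff (WithBot.bot_lt_coe _)).2 fun j hj => ?_
    refine (degree_C_mul_X_pow_le _ _).trans_lt ?_
    exact_mod_cast Finset.mem_range.1 hj
  have h3 := AdjoinRoot.dvd_coeff_of_dvd_mk hPm hdeg (c := 2 ^ e) (by exact_mod_cast h1) i
  have h4 : p.coeff i = f i - f (i + 2 ^ r) := by
    simp only [p, finsetSum_coeff, coeff_C_mul, coeff_X_pow, mul_ite, mul_one, mul_zero]
    rw [Finset.sum_ite_eq, if_pos (Finset.mem_range.2 hi)]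
  rwa [h4] at h3

theorem not_even_of_autocorrelation {a : ℕ → ℤ} {s u n : ℕ} (hs : 0 < s) (hu : Odd u)
    (hn : n = 2 ^ (2 * s + 2) * u ^ 2) (hodd : ∀ k, Odd (a k)) (ha : Function.Periodic a n)
    (hcorr : ∀ d, ∑ k ∈ Finset.range n, a k * a (k + d) = if n ∣ d then (n : ℤ) else 0) :
    False := by
  have hu0 : 0 < u := hu.pos
  have hfold : ∀ j ≤ s, ∀ i < 2 ^ (s + 2), (2 : ℤ) ^ (s + 1) ∣
      foldSum a (2 ^ (2 * s + 2 - j)) (2 ^ j * u ^ 2) i -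
        2 ^ j * foldSum a (2 ^ (2 * s + 2)) (u ^ 2) i := by
    intro j
    induction j with
    | zero => simp
    | succ j ih =>
      intro hj i hi
      obtain ⟨r, hr⟩ : ∃ r, 2 * s + 2 - j = r + 1 := ⟨2 * s + 1 - j, by omega⟩
      have hr' : 2 * s + 2 - (j + 1) = r := by omega
      have hnr : n = 2 ^ (r + 1) * (2 ^ j * u ^ 2) := by
        rw [hn, ← mul_assoc, ← pow_add]; congr 2; omega
      have hir : i < 2 ^ r := hi.trans_le (Nat.pow_le_pow_right two_pos (by omega))
      have h1 := ih (by omega) i hi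
      have h2 := two_pow_dvd_foldSum_sub (a := a) (r := r) (e := s + 1) (L := 2 ^ j * u ^ 2)
        (by positivity) (hnr ▸ ha) (hnr ▸ hcorr)
        (by
          rw [← hnr, hn, show 2 ^ (2 * s + 2) = 4 ^ (s + 1) by
            rw [show 4 = 2 ^ 2 by rfl, ← pow_mul]; congr 1]
          exact dvd_mul_right _ _) hir
      rw [hr] at h1
      rw [hr', show 2 ^ (j + 1) * u ^ 2 = 2 * (2 ^ j * u ^ 2) by ring, foldSum_two_mul,
        show 2 * 2 ^ r = 2 ^ (r + 1) by ring]
      refine (dvd_sub (h1.mul_left 2) h2).trans (dvd_of_eq ?_)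
      ring
  have hw : ∀ i < 2 ^ (s + 2), ∃ c : ℤ,
      foldSum a (2 ^ (s + 2)) (2 ^ s * u ^ 2) i ^ 2 = 4 ^ s * (8 * c + 1) := by
    intro i hi
    obtain ⟨z, hz⟩ := hfold s le_rfl i hi
    rw [show 2 * s + 2 - s = s + 2 by omega] at hz
    obtain ⟨b, hb⟩ := odd_foldSum hodd (2 ^ (2 * s + 2)) hu.pow i (L := u ^ 2)
    obtain ⟨c, hc⟩ := Int.eight_dvd_sq_sub_one_of_odd (k := 2 * (b + z) + 1) ⟨_, rfl⟩
    refine ⟨c, ?_⟩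
    rw [eq_add_of_sub_eq hz, hb, ← hc, show (4 : ℤ) ^ s = 2 ^ s * 2 ^ s by
      rw [← mul_pow]; norm_num]
    ring
  choose! c hc using hw
  have hns : n = 2 ^ (s + 2) * (2 ^ s * u ^ 2) := by rw [hn]; ring
  have hsum := sum_foldSum_sq (a := a) (M := 2 ^ (s + 2)) (L := 2 ^ s * u ^ 2) (by positivity)
    (by positivity) (hns ▸ ha) (hns ▸ hcorr)
  rw [Finset.sum_congr rfl fun i hi => hc i (Finset.mem_range.1 hi), ← Finset.mul_sum,
    Finset.sum_add_distrib, ← Finset.mul_sum, ← hns, hn] at hsum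
  have h4 : 8 * ∑ i ∈ Finset.range (2 ^ (s + 2)), c i + 2 ^ (s + 2) = 4 * (u : ℤ) ^ 2 := by
    refine mul_left_cancel₀ (pow_ne_zero s (four_ne_zero (α := ℤ))) ?_
    simp only [Finset.sum_const, Finset.card_range, nsmul_eq_mul, mul_one] at hsum
    push_cast at hsum
    rw [hsum, pow_add 2, pow_mul]
    ring
  obtain ⟨t, rfl⟩ := hu
  obtain ⟨s, rfl⟩ : ∃ m, s = m + 1 := ⟨s - 1, by omega⟩
  push_cast at h4
  ring_nf at h4
  omega

/-- Turyn's theorem: if `H` is a circulant Hadamard matrix of order `n = 4 h ^ 2`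
(`h` a positive integer), then `h` is odd. -/
theorem circulant_hadamard_h_odd (n h : ℕ) (hh : 0 < h) (hn : n = 4 * h ^ 2)
    (H : Matrix (Fin n) (Fin n) ℚ)
    (hent : ∀ i j, H i j = 1 ∨ H i j = -1)
    (hHad : H * Hᵀ = (n : ℚ) • (1 : Matrix (Fin n) (Fin n) ℚ))
    (hcirc : ∀ i j k : Fin n, H (i + k) (j + k) = H i j) :
    Odd h := by
  obtain ⟨s, u, hu, rfl⟩ := Nat.exists_eq_two_pow_mul_odd hh.ne'
  rcases Nat.eq_zero_or_pos s with rfl | hs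
  · simpa using hu
  exfalso
  have hn0 : 0 < n := by rw [hn]; positivity
  have : NeZero n := ⟨hn0.ne'⟩
  let a : ℕ → ℤ := fun k => if H 0 (Fin.ofNat n k) = 1 then 1 else -1
  have haH : ∀ k, (a k : ℚ) = H 0 (Fin.ofNat n k) := fun k => by
    rcases hent 0 (Fin.ofNat n k) with h1 | h1 <;> simp only [a, h1] <;> norm_num
  refine not_even_of_autocorrelation (a := a) (n := n) hs hu (by rw [hn]; ring) ?_ ?_ ?_
  · intro k
    simp only [a]
    split_ifs <;> decide
  · intro k
    have : Fin.ofNat n (k + n) = Fin.ofNat n k := by ext; simp [Fin.ofNat]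
    simp only [a, this]
  · intro d
    have h1 := congrFun (congrFun hHad 0) (-Fin.ofNat n d)
    have h2 : (∑ k ∈ Finset.range n, a k * a (k + d) : ℚ) = (H * Hᵀ) 0 (-Fin.ofNat n d) := by
      rw [Finset.sum_range, Matrix.mul_apply]
      refine Finset.sum_congr rfl fun k _ => ?_
      rw [Matrix.transpose_apply, haH, haH, ← hcirc (-Fin.ofNat n d) k (Fin.ofNat n d),
        neg_add_cancel]
      congr 2
      · simp
      · ext; simp [Fin.ofNat, Fin.val_add]
    have h3 : (0 : Fin n) = -Fin.ofNat n d ↔ n ∣ d := by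
      rw [eq_comm, neg_eq_zero, Fin.ext_iff]
      simp [Fin.ofNat, Nat.dvd_iff_mod_eq_zero]
    rw [h1, Matrix.smul_apply, Matrix.one_apply] at h2
    simp only [h3, smul_eq_mul, mul_ite, mul_one, mul_zero] at h2
    exact_mod_cast h2
end
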